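/- arXiv:1911.06585 — 2 statements merged into one kernel-verified Lean document; each statement's English description precedes it below -/
import Mathlib

section
/- Let c ∈ ℕ and let the weighted system (N,R,wt,K) be c-closed. Then for every nonterminal A ∈ N: Σ_{d ∈ (T_R)_A} wt(d)_K = ⊕_{d ∈ (T_R^{(c)})_A} wt(d)_K, where the left-hand side is the infinitary sum of K over the countable set (T_R)_A and the right-hand side is a finite ⊕-sum over the finite set (T_R^{(c)})_A. -/
open scoped Classical

/-- Trees over a ranked set `R` with arity function `ar`:
`RT.node r ts` is a tree whose root is labelled `r` and which has `ar r` children. -/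
inductive RT (R : Type) (ar : R → ℕ) : Type
  | node (r : R) (children : Fin (ar r) → RT R ar)

namespace RT

variable {R : Type} {ar : R → ℕ}

/-- The rule labelling the root of a tree. -/
def rootRule : RT R ar → R
  | node r _ => r

/-- The subtree at a position (`none` if the position is not a position of the tree). -/
def subAt : RT R ar → List ℕ → Option (RT R ar)
  | t, [] => some t
  | node r ts, i :: p => if h : i < ar r then subAt (ts ⟨i, h⟩) p else none

/-- Replace the subtree at a position by another tree. -/
def replaceAt : RT R ar → List ℕ → RT R ar → RT R ar
  | _, [], s => s
  | node r ts, i :: p, s => node r fun j => if j.1 = i then replaceAt (ts j) p s else ts j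

/-- The sequence of rule labels from the root to a position, inclusive. -/
def seqTo : RT R ar → List ℕ → Option (List R)
  | node r _, [] => some [r]
  | node r ts, i :: p => if h : i < ar r then (seqTo (ts ⟨i, h⟩) p).map (fun l => r :: l) else none

/-- `p` is a leaf position of `d`, i.e. a valid position with no child positions. -/
def LeafAt (d : RT R ar) (p : List ℕ) : Prop :=
  ∃ t, subAt d p = some t ∧ ar t.rootRule = 0

/-- The height of a tree: `0` on nullary nodes, otherwise `1` plus the maximum height
of the direct subtrees. -/
def height : RT R ar → ℕ
  | node _ ts => Finset.univ.sup fun i => height (ts i) + 1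

end RT

/-- The weight of a tree: evaluate it bottom-up, interpreting each rule `r` by the
operation `wt r`. -/
def wtval {K R : Type} {ar : R → ℕ} (wt : ∀ r : R, (Fin (ar r) → K) → K) : RT R ar → K
  | .node r ts => wt r fun i => wtval wt (ts i)

section Cyclicity

variable {R : Type} {ar : R → ℕ}

/-- A string over `R` is an elementary cycle if it has length `> 1`, its first and last
symbols coincide, and it becomes repetition-free after deleting its last (resp. first)
symbol. -/
def ElementaryCycle (w : List R) : Prop :=
  1 < w.length ∧ w.head? = w.getLast? ∧ w.dropLast.Nodup ∧ w.tail.Nodup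

/-- `ρ` is `(c,w)`-cyclic: `ρ = v₀ w v₁ ⋯ w v_c` (with `c` occurrences of the elementary
cycle `w`) where `w` is not an infix of any `vᵢ`. -/
def CWCyclic (c : ℕ) (w ρ : List R) : Prop :=
  ElementaryCycle w ∧
  ∃ v : ℕ → List R,
    ρ = v 0 ++ (((List.range c).map fun i => w ++ v (i + 1)).flatten) ∧
    ∀ i ≤ c, ¬ w <:+: v i

/-- `ρ` is `c`-cyclic: it is `(c,w)`-cyclic for some elementary cycle `w` and not
`(c',w')`-cyclic for any `c' > c` and elementary cycle `w'`. -/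
def CCyclic (c : ℕ) (ρ : List R) : Prop :=
  (∃ w, CWCyclic c w ρ) ∧ ∀ c', c < c' → ∀ w', ¬ CWCyclic c' w' ρ

/-- The leaf position `p` of `d` is `(c,w)`-cyclic. -/
def LeafCW (c : ℕ) (w : List R) (d : RT R ar) (p : List ℕ) : Prop :=
  RT.LeafAt d p ∧ ∃ ρ, RT.seqTo d p = some ρ ∧ CWCyclic c w ρ

/-- The leaf position `p` of `d` is `c`-cyclic. -/
def LeafC (c : ℕ) (d : RT R ar) (p : List ℕ) : Prop :=
  RT.LeafAt d p ∧ ∃ ρ, RT.seqTo d p = some ρ ∧ CCyclic c ρ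

/-- The tree `d` is `c`-cyclic: some leaf of `d` is `c`-cyclic and no leaf of `d` is
`c'`-cyclic for any `c' > c`. -/
def TreeC (c : ℕ) (d : RT R ar) : Prop :=
  (∃ p, LeafC c d p) ∧ ∀ c', c < c' → ∀ p, ¬ LeafC c' d p

/-- `d ⊢_w d'` : there are positions `p ≤ p'` of `d` whose connecting label sequence is
`w`, and `d'` is obtained by replacing the subtree at `p` by the subtree at `p'`.
(The position `p'` is `p ++ q`.) -/
def CutW (w : List R) (d d' : RT R ar) : Prop :=
  ∃ p q t s, RT.subAt d p = some t ∧ RT.subAt t q = some s ∧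
    RT.seqTo t q = some w ∧ d' = RT.replaceAt d p s

/-- `d ⊢ d'` : `d ⊢_w d'` for some elementary cycle `w`. -/
def Cut (d d' : RT R ar) : Prop := ∃ w, ElementaryCycle w ∧ CutW w d d'

/-- The set of `w`-cutout trees of `d`. -/
def cotreesW (w : List R) (d : RT R ar) : Set (RT R ar) := {d' | Relation.TransGen (CutW w) d d'}

/-- The set of cutout trees of `d`. -/
def cotrees (d : RT R ar) : Set (RT R ar) := {d' | Relation.TransGen Cut d d'}

end Cyclicity

section Rules

variable {N R : Type}

/-- Well-sorted trees over a rule system given by `lhs` and `rhs`: at each node labelled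
`r`, the `i`-th child is a well-sorted tree whose root label has left-hand side equal to
the `i`-th nonterminal of `rhs r`. -/
inductive WellSorted (lhs : R → N) (rhs : R → List N) :
    RT R (fun r => (rhs r).length) → Prop
  | node (r : R) (ts : Fin (rhs r).length → RT R fun r => (rhs r).length)
      (hsort : ∀ i, lhs (ts i).rootRule = (rhs r).get i)
      (hrec : ∀ i, WellSorted lhs rhs (ts i)) : WellSorted lhs rhs (RT.node r ts)

/-- `T_R` : the set of (well-sorted) trees over the rule system. -/
def TRset (lhs : R → N) (rhs : R → List N) : Set (RT R fun r => (rhs r).length) :=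
  {d | WellSorted lhs rhs d}

/-- `(T_R)_A` : the set of trees of sort `A`. -/
def TRA (lhs : R → N) (rhs : R → List N) (A : N) : Set (RT R fun r => (rhs r).length) :=
  {d | WellSorted lhs rhs d ∧ lhs d.rootRule = A}

/-- `T_R^{(c)}` : the set of trees that are `c'`-cyclic for some `c' ≤ c`. -/
def TRcset (lhs : R → N) (rhs : R → List N) (c : ℕ) : Set (RT R fun r => (rhs r).length) :=
  {d | WellSorted lhs rhs d ∧ ∃ c' ≤ c, TreeC c' d}

end Rules

/-- An infinitary sum operation on a commutative monoid `K`, turning it into a complete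
monoid: the sum of the empty family is `0`, the sum of a singleton family is its member,
the sum of a two-element family is the binary sum, and the partition law holds (every
partition of a countable index set `I` into sets indexed by `J` is given by the fibers
of a map `g : I → J`). -/
structure InfSum (K : Type) [AddCommMonoid K] where
  isum : ∀ {I : Type} [Countable I], (I → K) → K
  isum_empty : ∀ {I : Type} [Countable I] (f : I → K), IsEmpty I → isum f = 0
  isum_single : ∀ {I : Type} [Countable I] (f : I → K) (j : I), (∀ i, i = j) → isum f = f j
  isum_pair : ∀ {I : Type} [Countable I] (f : I → K) (j j' : I), j ≠ j' →
    (∀ i, i = j ∨ i = j') → isum f = f j + f j'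
  isum_partition : ∀ {I J : Type} [Countable I] [Countable J] (f : I → K) (g : I → J),
    isum f = isum fun j : J => isum fun i : {i : I // g i = j} => f i.1

section MMonoid

variable {K : Type} [AddCommMonoid K]

/-- A complete monoid is d-complete if, whenever all the partial sums `Σ_{i ≤ n} f i`
eventually equal `k`, the infinitary sum of the family equals `k`. -/
def InfSum.DComplete (S : InfSum K) : Prop :=
  ∀ (k : K) (f : ℕ → K),
    (∃ n₀ : ℕ, ∀ n, n₀ ≤ n → (∑ i ∈ Finset.range (n + 1), f i) = k) → S.isum f = k

/-- A complete monoid is completely idempotent if the infinitary sum of every constant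
family over a nonempty countable index set is that constant. -/
def InfSum.CompletelyIdempotent (S : InfSum K) : Prop :=
  ∀ (I : Type) [Countable I], Nonempty I → ∀ k : K, S.isum (fun _ : I => k) = k

/-- The family `Ω` of operation sets contains all the null (constantly `0`) operations. -/
def HasZeroOps (Ω : ∀ n : ℕ, Set ((Fin n → K) → K)) : Prop :=
  ∀ n : ℕ, (fun _ : Fin n → K => (0 : K)) ∈ Ω n

/-- Distributivity of an M-monoid: every operation in `Ω` distributes over `+` in each
argument, and `0` is absorbing for every operation in `Ω`. -/
def DistributiveOps (Ω : ∀ n : ℕ, Set ((Fin n → K) → K)) : Prop :=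
  ∀ n : ℕ, ∀ ω ∈ Ω n,
    (∀ (x : Fin n → K) (i : Fin n) (a b : K),
      ω (Function.update x i (a + b)) = ω (Function.update x i a) + ω (Function.update x i b)) ∧
    (∀ x : Fin n → K, (∃ i, x i = 0) → ω x = 0)

end MMonoid

/-- The weighted system `(N, R, wt, K)` is `c`-closed: for every well-sorted tree `d` and
elementary cycle `w` such that some leaf position of `d` is `(c+1,w)`-cyclic, the weight
of `d` is subsumed by the (finite) `⊕`-sum of the weights of the `w`-cutout trees of `d`. -/
def CClosed {K : Type} [AddCommMonoid K] {N R : Type} (lhs : R → N) (rhs : R → List N)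
    (wt : ∀ r : R, (Fin (rhs r).length → K) → K) (c : ℕ) : Prop :=
  ∀ d : RT R (fun r => (rhs r).length), WellSorted lhs rhs d →
    ∀ w : List R, ElementaryCycle w → (∃ p, LeafCW (c + 1) w d p) →
      (wtval wt d + ∑ᶠ d' ∈ cotreesW w d, wtval wt d') = ∑ᶠ d' ∈ cotreesW w d, wtval wt d'

namespace RT

variable {R : Type} {ar : R → ℕ}

/-- The number of nodes of a tree. -/
def numNodes : RT R ar → ℕ
  | node _ ts => 1 + ∑ i, numNodes (ts i)

theorem subAt_nil (d : RT R ar) : subAt d [] = some d := by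
  cases d; rfl

theorem subAt_cons_eq_some {r : R} {ts : Fin (ar r) → RT R ar} {i : ℕ} {p : List ℕ}
    {t : RT R ar} :
    subAt (node r ts) (i :: p) = some t ↔ ∃ h : i < ar r, subAt (ts ⟨i, h⟩) p = some t := by
  rw [subAt]; split_ifs with h <;> simp [h]

theorem seqTo_cons_eq_some {r : R} {ts : Fin (ar r) → RT R ar} {i : ℕ} {p : List ℕ}
    {ρ : List R} :
    seqTo (node r ts) (i :: p) = some ρ ↔
      ∃ h : i < ar r, ∃ l, seqTo (ts ⟨i, h⟩) p = some l ∧ r :: l = ρ := by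
  rw [seqTo]; split_ifs with h <;> simp [h]

theorem replaceAt_nil (d s : RT R ar) : replaceAt d [] s = s := by
  cases d; rfl

theorem replaceAt_cons {r : R} (ts : Fin (ar r) → RT R ar) {i : ℕ} (h : i < ar r)
    (p : List ℕ) (s : RT R ar) :
    replaceAt (node r ts) (i :: p) s =
      node r (Function.update ts ⟨i, h⟩ (replaceAt (ts ⟨i, h⟩) p s)) := by
  rw [replaceAt]
  congr 1
  funext j
  by_cases hj : j = ⟨i, h⟩
  · subst hj; simp
  · have : j.1 ≠ i := fun e => hj (Fin.ext e)
    simp [this, hj]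

theorem subAt_append {d t : RT R ar} {p q : List ℕ} (h : subAt d p = some t) :
    subAt d (p ++ q) = subAt t q := by
  induction p generalizing d with
  | nil => rw [subAt_nil] at h; cases h; rfl
  | cons i p ih =>
    obtain ⟨r, ts⟩ := d
    obtain ⟨hi, h⟩ := subAt_cons_eq_some.1 h
    rw [List.cons_append, subAt, dif_pos hi, ih h]

theorem subAt_replaceAt {d t : RT R ar} {p : List ℕ} (h : subAt d p = some t) (s : RT R ar) :
    subAt (replaceAt d p s) p = some s := by
  induction p generalizing d with
  | nil => rw [replaceAt_nil, subAt_nil]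
  | cons i p ih =>
    obtain ⟨r, ts⟩ := d
    obtain ⟨hi, h⟩ := subAt_cons_eq_some.1 h
    rw [replaceAt_cons ts hi, subAt_cons_eq_some]
    exact ⟨hi, by simpa using ih h⟩

theorem replaceAt_self {d t : RT R ar} {p : List ℕ} (h : subAt d p = some t) :
    replaceAt d p t = d := by
  induction p generalizing d with
  | nil => rw [subAt_nil] at h; cases h; rw [replaceAt_nil]
  | cons i p ih =>
    obtain ⟨r, ts⟩ := d
    obtain ⟨hi, h⟩ := subAt_cons_eq_some.1 h
    rw [replaceAt_cons ts hi, ih h, Function.update_eq_self]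

theorem replaceAt_injective {d t : RT R ar} {p : List ℕ} (h : subAt d p = some t) :
    Function.Injective (replaceAt d p) := fun s s' e => by
  have := subAt_replaceAt h s
  rw [e, subAt_replaceAt h s'] at this
  exact (Option.some.inj this).symm

theorem rootRule_replaceAt {d t s : RT R ar} {p : List ℕ} (h : subAt d p = some t)
    (hs : s.rootRule = t.rootRule) : (replaceAt d p s).rootRule = d.rootRule := by
  cases p with
  | nil => rw [subAt_nil] at h; cases h; rw [replaceAt_nil, hs]
  | cons i p => obtain ⟨r, ts⟩ := d; rfl

theorem numNodes_child_lt {r : R} (ts : Fin (ar r) → RT R ar) (i : Fin (ar r)) :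
    (ts i).numNodes < (node r ts).numNodes := by
  have := Finset.single_le_sum (f := fun i => (ts i).numNodes) (fun _ _ => Nat.zero_le _)
    (Finset.mem_univ i)
  simp only [numNodes] at *
  omega

theorem numNodes_subAt_le {d t : RT R ar} {p : List ℕ} (h : subAt d p = some t) :
    t.numNodes ≤ d.numNodes := by
  induction p generalizing d with
  | nil => rw [subAt_nil] at h; cases h; rfl
  | cons i p ih =>
    obtain ⟨r, ts⟩ := d
    obtain ⟨hi, h⟩ := subAt_cons_eq_some.1 h
    exact (ih h).trans (numNodes_child_lt ts _).le

theorem numNodes_subAt_lt {d t : RT R ar} {p : List ℕ} (h : subAt d p = some t)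
    (hp : p ≠ []) : t.numNodes < d.numNodes := by
  cases p with
  | nil => exact absurd rfl hp
  | cons i p =>
    obtain ⟨r, ts⟩ := d
    obtain ⟨hi, h⟩ := subAt_cons_eq_some.1 h
    exact (numNodes_subAt_le h).trans_lt (numNodes_child_lt ts _)

theorem numNodes_replaceAt_lt {d t s : RT R ar} {p : List ℕ} (h : subAt d p = some t)
    (hs : s.numNodes < t.numNodes) : (replaceAt d p s).numNodes < d.numNodes := by
  induction p generalizing d with
  | nil => rw [subAt_nil] at h; cases h; rwa [replaceAt_nil]
  | cons i p ih =>
    obtain ⟨r, ts⟩ := d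
    obtain ⟨hi, h⟩ := subAt_cons_eq_some.1 h
    rw [replaceAt_cons ts hi]
    simp only [numNodes]
    refine Nat.add_lt_add_left (Finset.sum_lt_sum (fun j _ => ?_)
      ⟨⟨i, hi⟩, Finset.mem_univ _, by simpa using ih h⟩) 1
    by_cases hj : j = ⟨i, hi⟩
    · subst hj; simpa using (ih h).le
    · simp [hj]

theorem height_lt_numNodes (d : RT R ar) : d.height < d.numNodes := by
  induction d with
  | node r ts ih =>
    have hpos : 0 < (node r ts).numNodes := by simp only [numNodes]; omega
    rw [height, Finset.sup_lt_iff hpos]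
    intro i _
    have := ih i
    have := numNodes_child_lt ts i
    omega

theorem finite_height_lt [Finite R] (h : ℕ) : {d : RT R ar | d.height < h}.Finite := by
  induction h with
  | zero => simp
  | succ h ih =>
    refine (Set.finite_iUnion fun r : R =>
      (Set.Finite.pi' fun _ : Fin (ar r) => ih).image (node r)).subset ?_
    rintro ⟨r, ts⟩ hd
    refine Set.mem_iUnion.2 ⟨r, ts, fun i => ?_, rfl⟩
    have := Finset.le_sup (f := fun i => height (ts i) + 1) (Finset.mem_univ i)
    simp only [Set.mem_ofPred_eq, height] at hd ⊢
    omega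

theorem finite_numNodes_le [Finite R] (n : ℕ) : {d : RT R ar | d.numNodes ≤ n}.Finite :=
  (finite_height_lt n).subset fun d hd => (height_lt_numNodes d).trans_le hd

theorem exists_leafAt_length_eq (d : RT R ar) :
    ∃ p ρ, LeafAt d p ∧ seqTo d p = some ρ ∧ ρ.length = d.height + 1 := by
  induction d with
  | node r ts ih =>
    by_cases h0 : ar r = 0
    · refine ⟨[], [r], ⟨_, subAt_nil _, h0⟩, rfl, ?_⟩
      have : IsEmpty (Fin (ar r)) := by rw [h0]; infer_instance
      simp [height]
    · have : Nonempty (Fin (ar r)) := ⟨⟨0, Nat.pos_of_ne_zero h0⟩⟩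
      obtain ⟨i, -, hi⟩ := Finset.exists_mem_eq_sup Finset.univ Finset.univ_nonempty
        fun i => height (ts i) + 1
      obtain ⟨p, ρ, ⟨t, ht, ht0⟩, hρ, hl⟩ := ih i
      refine ⟨i :: p, r :: ρ, ⟨t, subAt_cons_eq_some.2 ⟨i.2, ht⟩, ht0⟩,
        seqTo_cons_eq_some.2 ⟨i.2, ρ, hρ, rfl⟩, ?_⟩
      rw [height, hi, List.length_cons, hl]

theorem head?_of_seqTo {d : RT R ar} {p : List ℕ} {ρ : List R} (h : seqTo d p = some ρ) :
    ρ.head? = some d.rootRule := by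
  obtain ⟨r, ts⟩ := d
  cases p with
  | nil => cases h; rfl
  | cons i p => obtain ⟨_, l, _, rfl⟩ := seqTo_cons_eq_some.1 h; rfl

theorem getLast?_of_seqTo {d t : RT R ar} {p : List ℕ} {ρ : List R} (h : seqTo d p = some ρ)
    (ht : subAt d p = some t) : ρ.getLast? = some t.rootRule := by
  induction p generalizing d ρ with
  | nil => rw [subAt_nil] at ht; obtain ⟨r, ts⟩ := d; cases ht; cases h; rfl
  | cons i p ih =>
    obtain ⟨r, ts⟩ := d
    obtain ⟨hi, ht⟩ := subAt_cons_eq_some.1 ht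
    obtain ⟨_, l, hl, rfl⟩ := seqTo_cons_eq_some.1 h
    rw [List.getLast?_cons, ih hl ht]; rfl

/-- A proper split of the label sequence to `p` is realised by a split of `p`. -/
theorem exists_subAt_of_seqTo_append {d : RT R ar} {p : List ℕ} {a b : List R}
    (h : seqTo d p = some (a ++ b)) (hb : b ≠ []) :
    ∃ p₁ p₂ t, p = p₁ ++ p₂ ∧ subAt d p₁ = some t ∧ seqTo t p₂ = some b := by
  induction a generalizing d p with
  | nil => exact ⟨[], p, d, rfl, subAt_nil d, h⟩
  | cons x a ih =>
    obtain ⟨r, ts⟩ := d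
    cases p with
    | nil => simp [seqTo, hb] at h
    | cons i p =>
      obtain ⟨hi, l, hl, hlx⟩ := seqTo_cons_eq_some.1 h
      rw [List.cons_append, List.cons.injEq] at hlx
      rw [hlx.2] at hl
      obtain ⟨p₁, p₂, t, rfl, ht, hb⟩ := ih hl
      exact ⟨i :: p₁, p₂, t, rfl, subAt_cons_eq_some.2 ⟨hi, ht⟩, hb⟩

end RT

section DisjointOccurrences

variable {R : Type}

/-- The string `w` has at least `k` pairwise disjoint occurrences in `ρ`. -/
def HasDisjOcc (w : List R) : ℕ → List R → Prop
  | 0, _ => True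
  | k + 1, ρ => ∃ v ρ', ρ = v ++ (w ++ ρ') ∧ HasDisjOcc w k ρ'

namespace HasDisjOcc

variable {w ρ : List R} {k l : ℕ}

theorem append_left (h : HasDisjOcc w k ρ) (a : List R) : HasDisjOcc w k (a ++ ρ) := by
  cases k with
  | zero => trivial
  | succ k =>
    obtain ⟨v, ρ', rfl, h⟩ := h
    exact ⟨a ++ v, ρ', by simp, h⟩

theorem of_succ (h : HasDisjOcc w (k + 1) ρ) : HasDisjOcc w k ρ := by
  obtain ⟨v, ρ', rfl, h⟩ := h
  exact (h.append_left w).append_left v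

theorem mono (h : HasDisjOcc w l ρ) (hkl : k ≤ l) : HasDisjOcc w k ρ := by
  induction hkl with
  | refl => exact h
  | step _ ih => exact ih h.of_succ

theorem succ_of_isInfix {a : List R} (h : HasDisjOcc w k ρ) (ha : w <:+: a) :
    HasDisjOcc w (k + 1) (a ++ ρ) := by
  obtain ⟨s, t, rfl⟩ := ha
  exact ⟨s, t ++ ρ, by simp, h.append_left t⟩

theorem le_length (h : HasDisjOcc w k ρ) (hw : w ≠ []) : k ≤ ρ.length := by
  induction k generalizing ρ with
  | zero => exact Nat.zero_le _
  | succ k ih =>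
    obtain ⟨v, ρ', rfl, h⟩ := h
    have := ih h
    have := List.length_pos_of_ne_nil hw
    simp only [List.length_append]
    omega

/-- Dropping a prefix brings the number of disjoint occurrences down to exactly `k`. -/
theorem exists_suffix (h : HasDisjOcc w k ρ) (hw : w ≠ []) :
    ∃ a b, ρ = a ++ b ∧ HasDisjOcc w k b ∧ ¬ HasDisjOcc w (k + 1) b := by
  induction hn : ρ.length using Nat.strong_induction_on generalizing ρ with
  | _ n ih =>
    by_cases h' : HasDisjOcc w (k + 1) ρ
    · obtain ⟨v, ρ', rfl, h'⟩ := h'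
      have hpos := List.length_pos_of_ne_nil hw
      simp only [List.length_append] at hn
      obtain ⟨a, b, rfl, hb⟩ := ih ρ'.length (by omega) h' rfl
      exact ⟨v ++ (w ++ a), b, by simp, hb⟩
    · exact ⟨[], ρ, rfl, h, h'⟩

theorem cwCyclic (hw : ElementaryCycle w) (h : HasDisjOcc w k ρ)
    (h' : ¬ HasDisjOcc w (k + 1) ρ) : CWCyclic k w ρ := by
  refine ⟨hw, ?_⟩
  induction k generalizing ρ with
  | zero =>
    refine ⟨fun _ => ρ, by simp, fun _ _ hi => h' ?_⟩
    obtain ⟨s, t, rfl⟩ := hi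
    exact ⟨s, t, by simp, trivial⟩
  | succ k ih =>
    obtain ⟨u, ρ', rfl, h⟩ := h
    obtain ⟨v, hv, hvi⟩ := ih h fun h'' => h' ⟨u, ρ', rfl, h''⟩
    refine ⟨fun i => Nat.casesOn i u v, ?_, fun i hi hin => ?_⟩
    · rw [List.range_succ_eq_map, hv]
      simp [Function.comp_def]
    · cases i with
      | zero => exact h' (succ_of_isInfix (k := k + 1) ⟨[], ρ', rfl, h⟩ hin)
      | succ i => exact hvi i (Nat.le_of_succ_le_succ hi) hin

end HasDisjOcc

theorem ElementaryCycle.ne_nil {w : List R} (hw : ElementaryCycle w) : w ≠ [] := by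
  rintro rfl
  simp [ElementaryCycle] at hw

theorem CWCyclic.hasDisjOcc {k : ℕ} {w ρ : List R} (h : CWCyclic k w ρ) : HasDisjOcc w k ρ := by
  obtain ⟨-, v, rfl, -⟩ := h
  induction k generalizing v with
  | zero => trivial
  | succ k ih =>
    refine ⟨v 0, _, ?_, ih fun i => v (i + 1)⟩
    rw [List.range_succ_eq_map]
    simp [Function.comp_def]

/-- Every string with a repetition contains an elementary cycle. -/
theorem exists_elementaryCycle_isInfix {ρ : List R} (h : ¬ ρ.Nodup) :
    ∃ w, ElementaryCycle w ∧ w <:+: ρ := by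
  induction hn : ρ.length using Nat.strong_induction_on generalizing ρ with
  | _ n ih =>
    have hne : ρ ≠ [] := by rintro rfl; simp at h
    have hpos := List.length_pos_of_ne_nil hne
    by_cases ht : ρ.tail.Nodup
    · by_cases hd : ρ.dropLast.Nodup
      · refine ⟨ρ, ⟨?_, ?_, hd, ht⟩, List.infix_rfl⟩
        · by_contra hl
          obtain ⟨a, rfl⟩ := List.length_eq_one_iff.1 (show ρ.length = 1 by omega)
          simp at h
        · cases ρ with
          | nil => rfl
          | cons a m =>
            have ham : a ∈ m := by
              by_contra ham
              exact h (List.nodup_cons.2 ⟨ham, ht⟩)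
            obtain ⟨s, t, rfl⟩ := List.append_of_mem ham
            rcases t.eq_nil_or_concat with rfl | ⟨t, b, rfl⟩
            · simp [List.getLast?_cons]
            · exfalso
              have he : a :: (s ++ a :: (t ++ [b])) = (a :: (s ++ a :: t)) ++ [b] := by simp
              rw [List.concat_eq_append, he, List.dropLast_concat] at hd
              simp at hd
      · obtain ⟨w, hw, hi⟩ := ih _ (by rw [List.length_dropLast]; omega) hd rfl
        exact ⟨w, hw, hi.trans ⟨[], [ρ.getLast hne], List.dropLast_append_getLast hne⟩⟩
    · obtain ⟨w, hw, hi⟩ := ih _ (by rw [List.length_tail]; omega) ht rfl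
      exact ⟨w, hw, hi.trans (List.tail_suffix ρ).isInfix⟩

theorem finite_elementaryCycle [Fintype R] : {w : List R | ElementaryCycle w}.Finite := by
  refine (List.finite_length_le R (Fintype.card R + 1)).subset fun w hw => ?_
  have := hw.2.2.2.length_le_card
  rw [List.length_tail] at this
  simp only [Set.mem_ofPred_eq]
  omega

/-- Long strings contain many disjoint occurrences of one elementary cycle. -/
theorem exists_hasDisjOcc_of_length [Fintype R] (k : ℕ) :
    ∃ L, ∀ ρ : List R, L ≤ ρ.length → ∃ w, ElementaryCycle w ∧ HasDisjOcc w (k + 1) ρ := by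
  have : Fintype {w : List R // ElementaryCycle w} := finite_elementaryCycle.fintype
  have key : ∀ (m : ℕ) (ρ : List R), m * (Fintype.card R + 1) ≤ ρ.length →
      ∃ f : {w : List R // ElementaryCycle w} → ℕ, ∑ w, f w = m ∧ ∀ w, HasDisjOcc w.1 (f w) ρ := by
    intro m
    induction m with
    | zero => exact fun ρ _ => ⟨fun _ => 0, by simp, fun _ => trivial⟩
    | succ m ih =>
      intro ρ hρ
      rw [Nat.succ_mul] at hρ
      obtain ⟨f, hf, hfo⟩ := ih (ρ.drop (Fintype.card R + 1)) (by
        rw [List.length_drop]; omega)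
      obtain ⟨w₀, hw₀, hi⟩ := exists_elementaryCycle_isInfix
        (ρ := ρ.take (Fintype.card R + 1)) fun hnd => by
          have := hnd.length_le_card
          rw [List.length_take] at this
          omega
      refine ⟨fun w => f w + if w = ⟨w₀, hw₀⟩ then 1 else 0, ?_, fun w => ?_⟩
      · rw [Finset.sum_add_distrib, hf]; simp
      · rw [← List.take_append_drop (Fintype.card R + 1) ρ]
        dsimp only
        split_ifs with h
        · subst h; exact (hfo _).succ_of_isInfix hi
        · exact (hfo w).append_left _
  refine ⟨(Fintype.card {w : List R // ElementaryCycle w} * k + 1) * (Fintype.card R + 1),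
    fun ρ hρ => ?_⟩
  obtain ⟨f, hf, hfo⟩ := key _ ρ hρ
  obtain ⟨w, -, hw⟩ := Finset.exists_lt_of_sum_lt (s := Finset.univ)
    (f := fun _ : {w : List R // ElementaryCycle w} => k) (g := f) (by simp [hf])
  exact ⟨w.1, w.2, (hfo w).mono hw⟩

end DisjointOccurrences

section BoundedCyclicity

variable {R : Type} {ar : R → ℕ}

/-- A tree is at most `c`-cyclic iff no path to a leaf contains `c + 1` disjoint occurrences
of one elementary cycle. -/
theorem exists_treeC_le_iff {c : ℕ} {d : RT R ar} :
    (∃ c' ≤ c, TreeC c' d) ↔ ∀ p ρ w, RT.LeafAt d p → RT.seqTo d p = some ρ →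
      ElementaryCycle w → ¬ HasDisjOcc w (c + 1) ρ := by
  constructor
  · rintro ⟨c', hc', -, hmax⟩ p ρ w hp hρ hw hocc
    let P : ℕ → Prop := fun k => ∃ w, ElementaryCycle w ∧ HasDisjOcc w k ρ
    have hb : ∀ k, P k → k ≤ ρ.length := fun k ⟨w, hw, h⟩ => h.le_length hw.ne_nil
    have hP : P (c + 1) := ⟨w, hw, hocc⟩
    have hle := Nat.le_findGreatest (hb _ hP) hP
    obtain ⟨w', hw', hocc'⟩ := Nat.findGreatest_spec (hb _ hP) hP
    have hgt : ∀ k, Nat.findGreatest P ρ.length < k → ¬ P k := fun k hk hPk =>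
      Nat.findGreatest_is_greatest hk (hb k hPk) hPk
    refine hmax (Nat.findGreatest P ρ.length) (by omega) p ⟨hp, ρ, hρ, ⟨w', ?_⟩, ?_⟩
    · exact hocc'.cwCyclic hw' fun h => hgt _ (Nat.lt_succ_self _) ⟨w', hw', h⟩
    · exact fun k hk u hu => hgt k hk ⟨u, hu.1, hu.hasDisjOcc⟩
  · intro h
    let P : ℕ → Prop := fun k => ∃ p ρ w, RT.LeafAt d p ∧ RT.seqTo d p = some ρ ∧
      ElementaryCycle w ∧ HasDisjOcc w k ρ
    have hb : ∀ k, P k → k ≤ c := by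
      rintro k ⟨p, ρ, w, hp, hρ, hw, hocc⟩
      by_contra hk
      exact h p ρ w hp hρ hw (hocc.mono (by omega))
    have hP : P 0 := by
      obtain ⟨p, ρ, hp, hρ, -⟩ := d.exists_leafAt_length_eq
      exact ⟨p, ρ, [d.rootRule, d.rootRule], hp, hρ, by simp [ElementaryCycle], trivial⟩
    have hgt : ∀ k, Nat.findGreatest P c < k → ¬ P k := fun k hk hPk =>
      Nat.findGreatest_is_greatest hk (hb k hPk) hPk
    obtain ⟨p, ρ, w, hp, hρ, hw, hocc⟩ := Nat.findGreatest_spec (hb _ hP) hP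
    refine ⟨Nat.findGreatest P c, Nat.findGreatest_le c, ⟨p, hp, ρ, hρ, ⟨w, ?_⟩, ?_⟩, ?_⟩
    · exact hocc.cwCyclic hw fun h => hgt _ (Nat.lt_succ_self _) ⟨p, ρ, w, hp, hρ, hw, h⟩
    · exact fun k hk u hu => hgt k hk ⟨p, ρ, u, hp, hρ, hu.1, hu.hasDisjOcc⟩
    · rintro k hk p' ⟨hp', ρ', hρ', ⟨u, hu⟩, -⟩
      exact hgt k hk ⟨p', ρ', u, hp', hρ', hu.1, hu.hasDisjOcc⟩

theorem finite_TRcset {N : Type} [Fintype R] (lhs : R → N) (rhs : R → List N) (c : ℕ) :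
    (TRcset lhs rhs c).Finite := by
  obtain ⟨L, hL⟩ := exists_hasDisjOcc_of_length (R := R) c
  refine (RT.finite_height_lt L).subset fun d hd => ?_
  by_contra hlt
  obtain ⟨p, ρ, hp, hρ, hlen⟩ := d.exists_leafAt_length_eq
  rw [Set.mem_ofPred_eq] at hlt
  obtain ⟨w, hw, hocc⟩ := hL ρ (by omega)
  exact exists_treeC_le_iff.1 hd.2 p ρ w hp hρ hw hocc

end BoundedCyclicity

section Cutting

variable {N R : Type} {ar : R → ℕ} {w : List R}

theorem CutW.rootRule_eq_and_numNodes_lt {d d' : RT R ar} (hw : ElementaryCycle w)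
    (h : CutW w d d') : d'.rootRule = d.rootRule ∧ d'.numNodes < d.numNodes := by
  obtain ⟨p, q, t, s, ht, hs, hseq, rfl⟩ := h
  have hroot : s.rootRule = t.rootRule := by
    have := hw.2.1
    rw [RT.head?_of_seqTo hseq, RT.getLast?_of_seqTo hseq hs] at this
    exact (Option.some.inj this).symm
  have hq : q ≠ [] := by
    rintro rfl
    obtain ⟨r, ts⟩ := t
    cases hseq
    simp [ElementaryCycle] at hw
  exact ⟨RT.rootRule_replaceAt ht hroot, RT.numNodes_replaceAt_lt ht (RT.numNodes_subAt_lt hs hq)⟩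

theorem rootRule_eq_and_numNodes_lt_of_mem_cotreesW {d d' : RT R ar} (hw : ElementaryCycle w)
    (h : d' ∈ cotreesW w d) : d'.rootRule = d.rootRule ∧ d'.numNodes < d.numNodes := by
  induction h with
  | single h => exact h.rootRule_eq_and_numNodes_lt hw
  | tail _ h ih =>
    have := h.rootRule_eq_and_numNodes_lt hw
    exact ⟨this.1.trans ih.1, this.2.trans ih.2⟩

theorem finite_cotreesW [Finite R] (hw : ElementaryCycle w) (d : RT R ar) :
    (cotreesW w d).Finite :=
  (RT.finite_numNodes_le d.numNodes).subset fun _ h =>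
    (rootRule_eq_and_numNodes_lt_of_mem_cotreesW hw h).2.le

variable {lhs : R → N} {rhs : R → List N}

theorem WellSorted.subAt {d t : RT R fun r => (rhs r).length} {p : List ℕ}
    (hd : WellSorted lhs rhs d) (h : RT.subAt d p = some t) : WellSorted lhs rhs t := by
  induction p generalizing d with
  | nil => rw [RT.subAt_nil] at h; cases h; exact hd
  | cons i p ih =>
    obtain ⟨r, ts, -, hrec⟩ := hd
    obtain ⟨hi, h⟩ := RT.subAt_cons_eq_some.1 h
    exact ih (hrec _) h

theorem WellSorted.replaceAt {d t s : RT R fun r => (rhs r).length} {p : List ℕ}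
    (hd : WellSorted lhs rhs d) (h : RT.subAt d p = some t) (hs : WellSorted lhs rhs s)
    (hst : s.rootRule = t.rootRule) : WellSorted lhs rhs (RT.replaceAt d p s) := by
  induction p generalizing d with
  | nil => rwa [RT.replaceAt_nil]
  | cons i p ih =>
    obtain ⟨r, ts, hsort, hrec⟩ := hd
    obtain ⟨hi, h⟩ := RT.subAt_cons_eq_some.1 h
    rw [RT.replaceAt_cons (ar := fun r => (rhs r).length) ts hi]
    refine .node r _ (fun j => ?_) fun j => ?_ <;> by_cases hj : j = ⟨i, hi⟩
    · subst hj; rw [Function.update_self, RT.rootRule_replaceAt h hst, hsort]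
    · rw [Function.update_of_ne hj, hsort]
    · subst hj; rw [Function.update_self]; exact ih (hrec _) h
    · rw [Function.update_of_ne hj]; exact hrec j

theorem WellSorted.of_mem_cotreesW {d d' : RT R fun r => (rhs r).length}
    (hd : WellSorted lhs rhs d) (hw : ElementaryCycle w) (h : d' ∈ cotreesW w d) :
    WellSorted lhs rhs d' := by
  have step : ∀ e e' : RT R fun r => (rhs r).length, WellSorted lhs rhs e → CutW w e e' →
      WellSorted lhs rhs e' := by
    rintro e _ he ⟨p, q, t, s, ht, hs, hseq, rfl⟩
    refine he.replaceAt ht ((he.subAt ht).subAt hs) ?_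
    have := hw.2.1
    rw [RT.head?_of_seqTo hseq, RT.getLast?_of_seqTo hseq hs] at this
    exact (Option.some.inj this).symm
  induction h with
  | single h => exact step _ _ hd h
  | tail _ h ih => exact step _ _ ih h

end Cutting

section Weights

variable {N R K : Type} [AddCommMonoid K] {lhs : R → N} {rhs : R → List N}

/-- The weight of `d[s]_p` depends additively on the weight of `s`. -/
theorem exists_addMonoidHom_wtval_replaceAt {Ω : ∀ n : ℕ, Set ((Fin n → K) → K)}
    (hΩd : DistributiveOps Ω) {ar : R → ℕ} {wt : ∀ r : R, (Fin (ar r) → K) → K}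
    (hwt : ∀ r, wt r ∈ Ω (ar r)) {d t : RT R ar} {p : List ℕ} (h : RT.subAt d p = some t) :
    ∃ φ : K →+ K, ∀ s, wtval wt (RT.replaceAt d p s) = φ (wtval wt s) := by
  induction p generalizing d with
  | nil => exact ⟨AddMonoidHom.id K, fun s => by rw [RT.replaceAt_nil]; rfl⟩
  | cons i p ih =>
    obtain ⟨r, ts⟩ := d
    obtain ⟨hi, h⟩ := RT.subAt_cons_eq_some.1 h
    obtain ⟨φ, hφ⟩ := ih h
    obtain ⟨hadd, hzero⟩ := hΩd _ _ (hwt r)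
    let x : Fin (ar r) → K := fun j => wtval wt (ts j)
    refine ⟨{ toFun := fun a => wt r (Function.update x ⟨i, hi⟩ (φ a))
              map_zero' := hzero _ ⟨⟨i, hi⟩, by simp⟩
              map_add' := fun a b => by rw [map_add, hadd] }, fun s => ?_⟩
    rw [RT.replaceAt_cons ts hi, wtval]
    simp only [AddMonoidHom.coe_mk, ZeroHom.coe_mk]
    congr 1
    funext j
    by_cases hj : j = ⟨i, hi⟩
    · subst hj; simp [hφ]
    · simp [hj, x]

/-- In a `c`-closed system, the weight of a tree outside `T_R^{(c)}` is absorbed by finitely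
many smaller trees of the same sort. -/
theorem CClosed.exists_absorbing {Ω : ∀ n : ℕ, Set ((Fin n → K) → K)}
    (hΩd : DistributiveOps Ω) [Finite R] {wt : ∀ r : R, (Fin (rhs r).length → K) → K}
    (hwt : ∀ r, wt r ∈ Ω (rhs r).length) {c : ℕ} (hclosed : CClosed lhs rhs wt c) {A : N}
    {d : RT R fun r => (rhs r).length} (hd : d ∈ TRA lhs rhs A) (hdc : d ∉ TRcset lhs rhs c) :
    ∃ D : Finset (RT R fun r => (rhs r).length),
      (∀ e ∈ D, e ∈ TRA lhs rhs A ∧ e.numNodes < d.numNodes) ∧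
      wtval wt d + ∑ e ∈ D, wtval wt e = ∑ e ∈ D, wtval wt e := by
  have hcyc : ¬ ∃ c' ≤ c, TreeC c' d := fun h => hdc ⟨hd.1, h⟩
  rw [exists_treeC_le_iff] at hcyc
  push Not at hcyc
  obtain ⟨p, ρ, w, hp, hρ, hw, hocc⟩ := hcyc
  obtain ⟨a, b, rfl, hb, hb'⟩ := hocc.exists_suffix hw.ne_nil
  have hbne : b ≠ [] := by
    rintro rfl
    simpa using hb.le_length hw.ne_nil
  obtain ⟨p₁, p₂, t, rfl, ht, htb⟩ := RT.exists_subAt_of_seqTo_append hρ hbne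
  obtain ⟨u, hu, hu0⟩ := hp
  rw [RT.subAt_append ht] at hu
  have habs := hclosed t (hd.1.subAt ht) w hw ⟨p₂, ⟨u, hu, hu0⟩, b, htb, hb.cwCyclic hw hb'⟩
  rw [finsum_mem_eq_finite_toFinset_sum _ (finite_cotreesW hw t)] at habs
  obtain ⟨φ, hφ⟩ := exists_addMonoidHom_wtval_replaceAt hΩd hwt ht
  refine ⟨(finite_cotreesW hw t).toFinset.image (RT.replaceAt d p₁), ?_, ?_⟩
  · intro e he
    obtain ⟨s, hs, rfl⟩ := Finset.mem_image.1 he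
    rw [Set.Finite.mem_toFinset] at hs
    obtain ⟨hroot, hlt⟩ := rootRule_eq_and_numNodes_lt_of_mem_cotreesW hw hs
    exact ⟨⟨hd.1.replaceAt ht ((hd.1.subAt ht).of_mem_cotreesW hw hs) hroot,
      by rw [RT.rootRule_replaceAt ht hroot, hd.2]⟩, RT.numNodes_replaceAt_lt ht hlt⟩
  · rw [Finset.sum_image fun x _ y _ h => RT.replaceAt_injective ht h]
    have := congrArg φ habs
    rw [map_add, map_sum, ← hφ, RT.replaceAt_self ht] at this
    simpa only [hφ] using this

/-- Elements that are absorbed by smaller ones can be removed from a finite sum. -/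
theorem sum_eq_sum_of_absorbing {α : Type} (size : α → ℕ) (f : α → K) {X : Set α} {T : Finset α}
    (habs : ∀ d ∈ X, d ∉ T → ∃ D : Finset α, (∀ e ∈ D, e ∈ X ∧ size e < size d) ∧
      f d + ∑ e ∈ D, f e = ∑ e ∈ D, f e)
    (F : Finset α) (hTF : T ⊆ F) (hFX : ∀ d ∈ F, d ∈ X)
    (hF : ∀ d ∈ F, d ∉ T → ∀ e ∈ X, size e < size d → e ∈ F) :
    ∑ d ∈ F, f d = ∑ d ∈ T, f d := by
  induction hn : F.card generalizing F with
  | zero =>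
    rw [Finset.card_eq_zero] at hn
    rw [hn, Finset.subset_empty] at hTF
    rw [hn, hTF]
  | succ n ih =>
    rcases (F \ T).eq_empty_or_nonempty with h | h
    · rw [hTF.antisymm (Finset.sdiff_eq_empty_iff_subset.1 h)]
    · obtain ⟨d, hd, hmax⟩ := Finset.exists_max_image _ size h
      rw [Finset.mem_sdiff] at hd
      have hrest := ih (F.erase d)
        (fun e he => Finset.mem_erase.2 ⟨fun h => hd.2 (h ▸ he), hTF he⟩)
        (fun e he => hFX e (Finset.mem_of_mem_erase he))
        (fun e he heT e' he' hlt => by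
          have heF := Finset.mem_of_mem_erase he
          refine Finset.mem_erase.2 ⟨?_, hF e heF heT e' he' hlt⟩
          rintro rfl
          exact (hmax e (Finset.mem_sdiff.2 ⟨heF, heT⟩)).not_gt hlt)
        (by rw [Finset.card_erase_of_mem hd.1, hn]; rfl)
      obtain ⟨D, hD, hDsum⟩ := habs d (hFX d hd.1) hd.2
      have hDF : D ⊆ F.erase d := fun e he => Finset.mem_erase.2
        ⟨fun h => (hD e he).2.ne (h ▸ rfl), hF d hd.1 hd.2 e (hD e he).1 (hD e he).2⟩
      rw [← hrest, ← Finset.add_sum_erase F f hd.1, ← Finset.sum_sdiff hDF, add_left_comm, hDsum]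

end Weights

namespace InfSum

variable {K : Type} [AddCommMonoid K] (S : InfSum K)

theorem isum_equiv {I J : Type} [Countable I] [Countable J] (e : I ≃ J) (f : J → K) :
    S.isum (fun i => f (e i)) = S.isum f := by
  rw [S.isum_partition (fun i => f (e i)) e]
  congr 1
  funext j
  rw [S.isum_single _ ⟨e.symm j, e.apply_symm_apply j⟩ fun i => Subtype.ext (by simp [← i.2])]
  simp

theorem isum_finset {I : Type} (s : Finset I) (f : I → K) :
    S.isum (fun i : s => f i) = ∑ i ∈ s, f i := by
  induction s using Finset.induction_on with
  | empty => rw [S.isum_empty _ inferInstance, Finset.sum_empty]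
  | insert a s ha ih =>
    have hfalse : S.isum (fun i : {i : ↥(insert a s) // decide (i.1 = a) = false} => f i.1.1)
        = ∑ i ∈ s, f i := by
      rw [← ih]
      let e : {i : ↥(insert a s) // decide (i.1 = a) = false} ≃ s :=
        { toFun := fun i => ⟨i.1.1, (Finset.mem_insert.1 i.1.2).resolve_left
            (of_decide_eq_false i.2)⟩
          invFun := fun i => ⟨⟨i.1, Finset.mem_insert_of_mem i.2⟩,
            decide_eq_false fun h => ha (h ▸ i.2)⟩
          left_inv := fun _ => rfl
          right_inv := fun _ => rfl }
      exact S.isum_equiv e fun i => f i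
    have htrue : S.isum (fun i : {i : ↥(insert a s) // decide (i.1 = a) = true} => f i.1.1)
        = f a :=
      S.isum_single _ ⟨⟨a, Finset.mem_insert_self a s⟩, by simp⟩ fun i =>
        Subtype.ext (Subtype.ext (of_decide_eq_true i.2))
    rw [S.isum_partition _ fun i : ↥(insert a s) => decide (i.1 = a),
      S.isum_pair _ true false (by simp) (by simp), htrue, hfalse, Finset.sum_insert ha]

/-- In a d-complete monoid, a sum over a set with finitely many elements of each size is
determined by the eventual value of the partial sums by size. -/
theorem DComplete.isum_eq_of_size (hdc : S.DComplete) {α : Type} [Countable α]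
    (size : α → ℕ) (f : α → K) {X : Set α} (F : ℕ → Finset α)
    (hF : ∀ n d, d ∈ F n ↔ d ∈ X ∧ size d ≤ n) {k : K} {n₀ : ℕ}
    (hk : ∀ n, n₀ ≤ n → ∑ d ∈ F n, f d = k) : S.isum (fun d : X => f d) = k := by
  rw [S.isum_partition _ fun d : X => size d]
  refine hdc k _ ⟨n₀, fun n hn => ?_⟩
  rw [← hk n hn, ← Finset.sum_fiberwise_of_maps_to (t := Finset.range (n + 1)) (g := size)
    fun d hd => Finset.mem_range.2 (Nat.lt_succ_of_le ((hF n d).1 hd).2)]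
  refine Finset.sum_congr rfl fun m hm => ?_
  rw [← S.isum_finset]
  have hmn : m ≤ n := Nat.le_of_lt_succ (Finset.mem_range.1 hm)
  let e : {d : X // size d = m} ≃ ↥({d ∈ F n | size d = m} : Finset α) :=
    { toFun := fun d => ⟨d.1.1, Finset.mem_filter.2
        ⟨(hF n _).2 ⟨d.1.2, d.2.le.trans hmn⟩, d.2⟩⟩
      invFun := fun d => ⟨⟨d.1, ((hF n _).1 (Finset.mem_filter.1 d.2).1).1⟩,
        (Finset.mem_filter.1 d.2).2⟩
      left_inv := fun _ => rfl
      right_inv := fun _ => rfl }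
  exact S.isum_equiv e fun d => f d

end InfSum

/-- Theorem: in a `c`-closed weighted system, for every nonterminal `A` the infinitary
sum of the weights over all trees of sort `A` equals the finite `⊕`-sum of the weights
over the at most `c`-cyclic trees of sort `A`. -/
theorem isum_TRA_eq_finite_sum_TRc {N R K : Type} [Fintype N] [Nonempty N] [Fintype R]
    [AddCommMonoid K] (lhs : R → N) (rhs : R → List N)
    [Countable (RT R fun r => (rhs r).length)]
    (S : InfSum K) (hdc : S.DComplete)
    (Ω : ∀ n : ℕ, Set ((Fin n → K) → K)) (hΩ0 : HasZeroOps Ω) (hΩd : DistributiveOps Ω)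
    (wt : ∀ r : R, (Fin (rhs r).length → K) → K) (hwt : ∀ r : R, wt r ∈ Ω (rhs r).length)
    (c : ℕ) (hclosed : CClosed lhs rhs wt c) :
    ∀ A : N,
      S.isum (fun d : ↥(TRA lhs rhs A) => wtval wt d.1)
        = ∑ᶠ d ∈ TRcset lhs rhs c ∩ TRA lhs rhs A, wtval wt d := by
  intro A
  have hTfin : (TRcset lhs rhs c ∩ TRA lhs rhs A).Finite :=
    (finite_TRcset lhs rhs c).inter_of_left _
  have hXfin : ∀ n, (TRA lhs rhs A ∩ {d | d.numNodes ≤ n}).Finite := fun n =>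
    (RT.finite_numNodes_le n).inter_of_right _
  rw [finsum_mem_eq_finite_toFinset_sum _ hTfin]
  refine hdc.isum_eq_of_size S RT.numNodes (wtval wt) (fun n => (hXfin n).toFinset)
    (fun n d => by simp) (n₀ := hTfin.toFinset.sup RT.numNodes) fun n hn => ?_
  refine sum_eq_sum_of_absorbing RT.numNodes (wtval wt) (X := TRA lhs rhs A) ?_ _ ?_ ?_ ?_
  · intro d hd hdT
    exact hclosed.exists_absorbing hΩd hwt hd fun h => hdT (hTfin.mem_toFinset.2 ⟨h, hd⟩)
  · intro d hd
    exact (hXfin n).mem_toFinset.2 ⟨(hTfin.mem_toFinset.1 hd).2,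
      (Finset.le_sup (f := RT.numNodes) hd).trans hn⟩
  · exact fun d hd => ((hXfin n).mem_toFinset.1 hd).1
  · intro d hd _ e he hlt
    exact (hXfin n).mem_toFinset.2 ⟨he, hlt.le.trans ((hXfin n).mem_toFinset.1 hd).2⟩
end

section
/- Let c ∈ ℕ, let the weighted system (N,R,wt,K) be c-closed, and consider the value computation recursion (V_n, 𝒱_n). Then for every d ∈ T_R, every n ∈ ℕ, and every nonterminal A ∈ N: if d ∈ 𝒱_n(A), then cotrees(d) ⊆ 𝒱_n(A). -/
open scoped Classical

section ValueComputation

variable {K : Type} [AddCommMonoid K] {N R : Type} [Fintype N] [Nonempty N] [Fintype R]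

/-- `select e n` : the nonterminal treated in the `n`-th iteration of the inner for loop,
given an enumeration `e` of the nonterminals. -/
def select (e : Fin (Fintype.card N) → N) (n : ℕ) : N :=
  e ⟨n % Fintype.card N, Nat.mod_lt _ Fintype.card_pos⟩

/-- The value computation recursion `V_n : N → K`. -/
noncomputable def Vrec (lhs : R → N) (rhs : R → List N)
    (wt : ∀ r : R, (Fin (rhs r).length → K) → K)
    (e : Fin (Fintype.card N) → N) : ℕ → N → K
  | 0, _ => 0
  | n + 1, A =>
      if select e n = A then
        ∑ᶠ r ∈ {r : R | lhs r = A}, wt r fun i => Vrec lhs rhs wt e n ((rhs r).get i)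
      else Vrec lhs rhs wt e n A

/-- The derivation-set recursion `𝒱_n : N → P(T_R)`. -/
noncomputable def Mrec (lhs : R → N) (rhs : R → List N) (e : Fin (Fintype.card N) → N) :
    ℕ → N → Set (RT R fun r => (rhs r).length)
  | 0, _ => ∅
  | n + 1, A =>
      if select e n = A then
        {d | ∃ (r : R) (_ : lhs r = A) (ts : Fin (rhs r).length → RT R fun r => (rhs r).length),
          d = RT.node r ts ∧ ∀ i, ts i ∈ Mrec lhs rhs e n ((rhs r).get i)}
      else Mrec lhs rhs e n A

end ValueComputation

namespace RT

variable {R : Type} {ar : R → ℕ}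

theorem seqTo_head? {t : RT R ar} {q : List ℕ} {w : List R} (h : seqTo t q = some w) :
    w.head? = some t.rootRule := by
  obtain ⟨r, ts⟩ := t
  cases q with
  | nil =>
    simp only [seqTo, Option.some.injEq] at h
    subst h
    rfl
  | cons i q =>
    simp only [seqTo] at h
    split at h
    · obtain ⟨l, -, rfl⟩ := Option.map_eq_some_iff.1 h
      rfl
    · cases h

theorem seqTo_getLast? {t s : RT R ar} {q : List ℕ} {w : List R} (h : seqTo t q = some w)
    (hs : subAt t q = some s) : w.getLast? = some s.rootRule := by
  induction q generalizing t w with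
  | nil =>
    obtain ⟨r, ts⟩ := t
    simp only [seqTo, subAt, Option.some.injEq] at h hs
    subst h hs
    rfl
  | cons i q ih =>
    obtain ⟨r, ts⟩ := t
    simp only [seqTo, subAt] at h hs
    split at h
    · rename_i hi
      rw [dif_pos hi] at hs
      obtain ⟨l, hl, rfl⟩ := Option.map_eq_some_iff.1 h
      have := ih hl hs
      rw [List.getLast?_cons, this]
      rfl
    · cases h

end RT

section ValueComputation

variable {N R : Type} [Fintype N] [Nonempty N]
  {lhs : R → N} {rhs : R → List N} {e : Fin (Fintype.card N) → N}

/-- A member of `Mrec n A` was built at some earlier iteration `m < n` that selected `A`. -/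
theorem node_mem_Mrec {n : ℕ} {A : N} {r : R}
    {ts : Fin (rhs r).length → RT R fun r => (rhs r).length}
    (h : RT.node r ts ∈ Mrec lhs rhs e n A) :
    lhs r = A ∧ ∃ m < n, select e m = A ∧ ∀ i, ts i ∈ Mrec lhs rhs e m ((rhs r).get i) := by
  induction n with
  | zero => exact h.elim
  | succ n ih =>
    rw [Mrec] at h
    split at h
    · rename_i hA
      obtain ⟨r', hr, ts', heq, hts⟩ := h
      cases heq
      exact ⟨hr, n, n.lt_succ_self, hA, hts⟩
    · obtain ⟨hr, m, hm, hrest⟩ := ih h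
      exact ⟨hr, m, hm.trans n.lt_succ_self, hrest⟩

theorem node_mem_Mrec_succ {m : ℕ} {r : R}
    {ts : Fin (rhs r).length → RT R fun r => (rhs r).length} (hsel : select e m = lhs r)
    (hts : ∀ i, ts i ∈ Mrec lhs rhs e m ((rhs r).get i)) :
    RT.node r ts ∈ Mrec lhs rhs e (m + 1) (lhs r) := by
  rw [Mrec, if_pos hsel]
  exact ⟨r, rfl, ts, rfl, hts⟩

theorem Mrec_mono {m n : ℕ} (hmn : m ≤ n) (A : N) :
    Mrec lhs rhs e m A ⊆ Mrec lhs rhs e n A := by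
  induction n generalizing m A with
  | zero => rw [Nat.le_zero.1 hmn]
  | succ n ih =>
    rcases hmn.eq_or_lt with rfl | hlt
    · exact subset_rfl
    rintro ⟨r, ts⟩ hd
    by_cases hA : select e n = A
    · obtain ⟨rfl, k, hk, -, hts⟩ := node_mem_Mrec hd
      exact node_mem_Mrec_succ hA fun i => ih (by omega) _ (hts i)
    · rw [Mrec, if_neg hA]
      exact ih (by omega) A hd

theorem lhs_rootRule_of_mem_Mrec {n : ℕ} {A : N} {d : RT R fun r => (rhs r).length}
    (h : d ∈ Mrec lhs rhs e n A) : lhs d.rootRule = A := by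
  obtain ⟨r, ts⟩ := d
  exact (node_mem_Mrec h).1

theorem subAt_mem_Mrec {n : ℕ} {A : N} {t s : RT R fun r => (rhs r).length} {q : List ℕ}
    (ht : t ∈ Mrec lhs rhs e n A) (hs : t.subAt q = some s) :
    s ∈ Mrec lhs rhs e n (lhs s.rootRule) := by
  induction q generalizing t A with
  | nil =>
    rw [RT.subAt, Option.some.injEq] at hs
    subst hs
    rwa [lhs_rootRule_of_mem_Mrec ht]
  | cons i q ih =>
    obtain ⟨r, ts⟩ := t
    obtain ⟨-, m, hm, -, hts⟩ := node_mem_Mrec ht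
    rw [RT.subAt] at hs
    split at hs
    · rename_i hi
      exact ih (Mrec_mono hm.le _ (hts ⟨i, hi⟩)) hs
    · cases hs

theorem replaceAt_mem_Mrec {n : ℕ} {A : N} {d t s : RT R fun r => (rhs r).length} {p : List ℕ}
    (hd : d ∈ Mrec lhs rhs e n A) (ht : d.subAt p = some t)
    (hts : ∀ k B, t ∈ Mrec lhs rhs e k B → s ∈ Mrec lhs rhs e k B) :
    d.replaceAt p s ∈ Mrec lhs rhs e n A := by
  induction p generalizing d n A with
  | nil =>
    rw [RT.subAt, Option.some.injEq] at ht
    subst ht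
    rw [RT.replaceAt]
    exact hts n A hd
  | cons i p ih =>
    obtain ⟨r, us⟩ := d
    obtain ⟨rfl, m, hm, hsel, hus⟩ := node_mem_Mrec hd
    rw [RT.subAt] at ht
    split at ht
    · rw [RT.replaceAt]
      refine Mrec_mono hm _ (node_mem_Mrec_succ hsel fun j => ?_)
      by_cases hj : j.1 = i
      · subst hj
        rw [if_pos rfl]
        exact ih (hus j) ht
      · rw [if_neg hj]
        exact hus j
    · cases ht

theorem Cut.mem_Mrec {n : ℕ} {A : N} {d d' : RT R fun r => (rhs r).length} (hcut : Cut d d')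
    (hd : d ∈ Mrec lhs rhs e n A) : d' ∈ Mrec lhs rhs e n A := by
  obtain ⟨w, hw, p, q, t, s, ht, hs, hseq, rfl⟩ := hcut
  have hroot : t.rootRule = s.rootRule := by
    have := hw.2.1
    rwa [RT.seqTo_head? hseq, RT.seqTo_getLast? hseq hs, Option.some.injEq] at this
  refine replaceAt_mem_Mrec hd ht fun k B htB => ?_
  have := subAt_mem_Mrec htB hs
  rwa [← hroot, lhs_rootRule_of_mem_Mrec htB] at this

end ValueComputation

/-- In a `c`-closed weighted system, the sets `𝒱_n(A)` computed by the value computation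
algorithm are closed under taking cutout trees. -/
theorem cotrees_subset_Mrec {N R K : Type} [Fintype N] [Nonempty N] [Fintype R]
    [AddCommMonoid K]
    (S : InfSum K) (hdc : S.DComplete)
    (Ω : ∀ n : ℕ, Set ((Fin n → K) → K)) (hΩ0 : HasZeroOps Ω) (hΩd : DistributiveOps Ω)
    (lhs : R → N) (rhs : R → List N)
    (wt : ∀ r : R, (Fin (rhs r).length → K) → K) (hwt : ∀ r : R, wt r ∈ Ω (rhs r).length)
    (c : ℕ) (hclosed : CClosed lhs rhs wt c)
    (e : Fin (Fintype.card N) → N) (he : Function.Bijective e) :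
    ∀ (d : RT R fun r => (rhs r).length) (n : ℕ) (A : N),
      d ∈ Mrec lhs rhs e n A → cotrees d ⊆ Mrec lhs rhs e n A := by
  intro d n A hd d' hd'
  induction hd' with
  | single hcut => exact hcut.mem_Mrec hd
  | tail _ hcut ih => exact hcut.mem_Mrec ih
end
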